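/- Let t > 0, and let K be holomorphic on the open unit disc 𝔻 with K(0) = 1, Re K > 0 on 𝔻, and ((K(z)−1)/(K(z)+1))e^{tK(z)} = z for all z ∈ 𝔻. Then the power series 2 Σ_{j≥1} e^{−jt} L_{j−1}^{(1)}(2jt) z^j converges for all z ∈ 𝔻 and equals z·K′(z); equivalently, (t·K(z)² + (2−t)) · z·K′(z) = K(z)² − 1 for all z ∈ 𝔻. -/

import Mathlib

open scoped BigOperators

/-- Pochhammer symbol `(a)_k = a(a+1)⋯(a+k-1)` over ℝ. -/
noncomputable def pochR (a : ℝ) (k : ℕ) : ℝ := ∏ i ∈ Finset.range k, (a + i)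

/-- Generalized Laguerre polynomial `L_n^{(α)}(x)`. -/
noncomputable def Lag (n : ℕ) (α : ℝ) (x : ℝ) : ℝ :=
  (1 / (n.factorial : ℝ)) * ∑ j ∈ Finset.range (n + 1),
    (pochR (-(n : ℝ)) j / (j.factorial : ℝ)) * pochR (α + j + 1) (n - j) * x ^ j

lemma pochR_neg (n j : ℕ) (h : j ≤ n) :
    pochR (-(n : ℝ)) j * ((n - j).factorial : ℝ) = (-1) ^ j * (n.factorial : ℝ) := by
  induction j with
  | zero => simp [pochR]
  | succ j ih =>
    have h1 := ih (by omega)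
    have h2 : n - j = (n - (j + 1)) + 1 := by omega
    have h3 : ((n - j : ℕ) : ℝ) = (n : ℝ) - j := by
      rw [Nat.cast_sub (by omega)]
    rw [h2, Nat.factorial_succ, ← h2] at h1
    push_cast [h3] at h1
    unfold pochR at *
    rw [Finset.prod_range_succ, pow_succ]
    linear_combination -h1

lemma pochR_nat (a k : ℕ) :
    pochR ((a : ℝ) + 1) k * (a.factorial : ℝ) = ((a + k).factorial : ℝ) := by
  induction k with
  | zero => simp [pochR]
  | succ k ih =>
    unfold pochR at *
    rw [Finset.prod_range_succ, ← add_assoc, Nat.factorial_succ]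
    push_cast
    rw [← ih]
    ring

lemma Lag_eq (n : ℕ) (x : ℝ) :
    Lag n 1 x = ∑ m ∈ Finset.range (n + 1),
      (-x) ^ m / (m.factorial : ℝ) * ((n + 1).choose (m + 1) : ℝ) := by
  unfold Lag
  rw [Finset.mul_sum]
  refine Finset.sum_congr rfl fun m hm => ?_
  have hm' : m ≤ n := by
    have := Finset.mem_range.mp hm
    omega
  have h1 := pochR_neg n m hm'
  have h2 := pochR_nat (m + 1) (n - m)
  rw [show m + 1 + (n - m) = n + 1 by omega] at h2
  have h3 := Nat.choose_mul_factorial_mul_factorial (show m + 1 ≤ n + 1 by omega)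
  rw [show n + 1 - (m + 1) = n - m by omega] at h3
  have h3' : ((n + 1).choose (m + 1) : ℝ) * ((m + 1).factorial : ℝ) * ((n - m).factorial : ℝ)
      = ((n + 1).factorial : ℝ) := by exact_mod_cast h3
  have e : (1 : ℝ) + m + 1 = ((m + 1 : ℕ) : ℝ) + 1 := by push_cast; ring
  rw [e]
  have f1 : (n.factorial : ℝ) ≠ 0 := by positivity
  have f2 : (m.factorial : ℝ) ≠ 0 := by positivity
  have f3 : ((m + 1).factorial : ℝ) ≠ 0 := by positivity
  have f4 : ((n - m).factorial : ℝ) ≠ 0 := by positivity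
  have a1 := eq_div_of_mul_eq f4 h1
  have a2 := eq_div_of_mul_eq f3 h2
  have a3 := eq_div_of_mul_eq f3 (eq_div_of_mul_eq f4 h3')
  rw [a1, a2, a3, neg_pow x m]
  field_simp

lemma exp_taylor (n : ℕ) : ∃ E : ℂ → ℂ, Differentiable ℂ E ∧
    ∀ w, Complex.exp w = ∑ m ∈ Finset.range (n + 1), w ^ m / (m.factorial : ℂ)
      + w ^ (n + 1) * E w := by
  set g : ℂ → ℂ := fun w =>
    (Complex.exp w - ∑ m ∈ Finset.range (n + 1), w ^ m / (m.factorial : ℂ)) / w ^ (n + 1) with hg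
  have hd : DifferentiableOn ℂ g (Metric.ball 0 1 \ {0}) := by
    intro w hw
    have : w ^ (n + 1) ≠ 0 := pow_ne_zero _ hw.2
    refine DifferentiableAt.differentiableWithinAt ?_
    simp only [hg]
    fun_prop (disch := assumption)
  have hb : BddAbove (norm ∘ g '' (Metric.ball 0 1 \ {0})) := by
    refine ⟨((n + 1).succ : ℝ) * (((n + 1).factorial : ℝ) * ((n + 1 : ℕ) : ℝ))⁻¹, ?_⟩
    rintro _ ⟨w, hw, rfl⟩
    have h1 : ‖w‖ ≤ 1 := by
      have := hw.1
      rw [mem_ball_zero_iff] at this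
      exact this.le
    have h0 : 0 < ‖w‖ := norm_pos_iff.mpr hw.2
    have := Complex.exp_bound h1 (Nat.succ_pos n)
    simp only [Function.comp, hg, norm_div, norm_pow]
    rw [div_le_iff₀ (by positivity), mul_comm]
    exact this
  have hU := Complex.differentiableOn_update_limUnder_of_bddAbove
    (Metric.ball_mem_nhds (0 : ℂ) one_pos) hd hb
  set E := Function.update g 0 (Filter.limUnder (nhdsWithin (0 : ℂ) {0}ᶜ) g) with hE
  refine ⟨E, ?_, ?_⟩
  · intro w
    by_cases hw : w = 0
    · subst hw
      exact hU.differentiableAt (Metric.ball_mem_nhds (0 : ℂ) one_pos)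
    · have h2 : w ^ (n + 1) ≠ 0 := pow_ne_zero _ hw
      have h1 : DifferentiableAt ℂ g w := by
        simp only [hg]
        fun_prop (disch := assumption)
      refine h1.congr_of_eventuallyEq ?_
      filter_upwards [isOpen_ne.mem_nhds hw] with v hv
      rw [hE, Function.update_of_ne hv]
  · intro w
    by_cases hw : w = 0
    · subst hw
      simp [Finset.sum_range_succ']
    · have h2 : w ^ (n + 1) ≠ 0 := pow_ne_zero _ hw
      rw [hE, Function.update_of_ne hw]
      simp only [hg]
      field_simp
      ring

lemma binom_tele (n d : ℕ) (u : ℂ) :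
    (1 - u) * ∑ k ∈ Finset.range (n + 1), ((k + (d + 1)).choose (d + 1) : ℂ) * u ^ k
      = ∑ k ∈ Finset.range (n + 1), ((k + d).choose d : ℂ) * u ^ k
        - ((n + d + 1).choose (d + 1) : ℂ) * u ^ (n + 1) := by
  induction n with
  | zero => simp
  | succ n ih =>
    rw [Finset.sum_range_succ, mul_add, ih, Finset.sum_range_succ _ (n + 1)]
    have : ((n + 1 + d + 1).choose (d + 1) : ℂ)
        = ((n + 1 + d).choose d : ℂ) + ((n + d + 1).choose (d + 1) : ℂ) := by
      rw [show n + d + 1 = n + 1 + d by omega]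
      exact_mod_cast Nat.choose_succ_succ (n + 1 + d) d
    rw [← add_assoc (n + 1), this]
    ring

lemma binom_taylor (n d : ℕ) : ∃ R : ℂ → ℂ, DifferentiableOn ℂ R (Metric.ball 0 1) ∧
    ∀ u ∈ Metric.ball (0 : ℂ) 1, ((1 - u)⁻¹) ^ (d + 1) =
      ∑ k ∈ Finset.range (n + 1), ((k + d).choose d : ℂ) * u ^ k + u ^ (n + 1) * R u := by
  have hne : ∀ u ∈ Metric.ball (0 : ℂ) 1, 1 - u ≠ 0 := by
    intro u hu h
    have : u = 1 := by linear_combination -h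
    rw [mem_ball_zero_iff, this] at hu
    simp at hu
  induction d with
  | zero =>
    refine ⟨fun u => (1 - u)⁻¹, ?_, ?_⟩
    · intro u hu
      have := hne u hu
      refine DifferentiableAt.differentiableWithinAt ?_
      fun_prop (disch := assumption)
    · intro u hu
      have := hne u hu
      have h := mul_neg_geom_sum u (n + 1)
      simp only [zero_add, pow_one, Nat.choose_zero_right, Nat.cast_one, one_mul]
      field_simp
      linear_combination -h
  | succ d ih =>
    obtain ⟨R, hR, hR'⟩ := ih
    refine ⟨fun u => (((n + d + 1).choose (d + 1) : ℂ) + R u) * (1 - u)⁻¹, ?_, ?_⟩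
    · refine (hR.const_add _).mul ?_
      intro u hu
      have := hne u hu
      refine DifferentiableAt.differentiableWithinAt ?_
      fun_prop (disch := assumption)
    · intro u hu
      have := hne u hu
      rw [pow_succ, hR' u hu, ← mul_right_inj' this]
      have h := binom_tele n d u
      rw [mul_add, h]
      field_simp
      ring

open Polynomial in
lemma gen_taylor (n : ℕ) (x : ℝ) : ∃ (P : ℂ[X]) (R : ℂ → ℂ),
    DifferentiableOn ℂ R (Metric.ball 0 1) ∧ P.coeff n = ((Lag n 1 x : ℝ) : ℂ) ∧
    ∀ u ∈ Metric.ball (0 : ℂ) 1,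
      Complex.exp (-(x : ℂ) * (u * (1 - u)⁻¹)) * ((1 - u)⁻¹) ^ 2
        = P.eval u + u ^ (n + 1) * R u := by
  have hne : ∀ u ∈ Metric.ball (0 : ℂ) 1, 1 - u ≠ 0 := by
    intro u hu h
    have : u = 1 := by linear_combination -h
    rw [mem_ball_zero_iff, this] at hu
    simp at hu
  obtain ⟨E, hE, hE'⟩ := exp_taylor n
  choose R hR hR' using fun d => binom_taylor n d
  have hinv : DifferentiableOn ℂ (fun u : ℂ => (1 - u)⁻¹) (Metric.ball 0 1) := by
    intro u hu
    have := hne u hu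
    refine DifferentiableAt.differentiableWithinAt ?_
    fun_prop (disch := assumption)
  refine ⟨∑ m ∈ Finset.range (n + 1), C ((-(x : ℂ)) ^ m / (m.factorial : ℂ)) *
      ((∑ k ∈ Finset.range (n + 1), C ((k + (m + 1)).choose (m + 1) : ℂ) * X ^ k) * X ^ m),
    fun u => ∑ m ∈ Finset.range (n + 1), ((-(x : ℂ)) ^ m / (m.factorial : ℂ)) *
      (u ^ m * R (m + 1) u) + (-(x : ℂ) * (1 - u)⁻¹) ^ (n + 1) *
        E (-(x : ℂ) * (u * (1 - u)⁻¹)) * ((1 - u)⁻¹) ^ 2, ?_, ?_, ?_⟩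
  · refine DifferentiableOn.add ?_ (DifferentiableOn.mul (DifferentiableOn.mul ?_ ?_) (hinv.pow 2))
    · refine DifferentiableOn.fun_sum fun m _ => ?_
      exact (((differentiable_id.pow m).differentiableOn).mul (hR (m + 1))).const_mul _
    · exact (hinv.const_mul _).pow _
    · exact hE.comp_differentiableOn ((differentiableOn_id.mul hinv).const_mul _)
  · rw [Lag_eq, finsetSum_coeff]
    push_cast
    refine Finset.sum_congr rfl fun m hm => ?_
    have hm' : m ≤ n := by
      have := Finset.mem_range.mp hm
      omega
    rw [coeff_C_mul, coeff_mul_X_pow', if_pos hm', finsetSum_coeff]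
    congr 1
    rw [Finset.sum_eq_single (n - m)]
    · rw [coeff_C_mul, coeff_X_pow, if_pos rfl, mul_one]
      rw [show n - m + (m + 1) = n + 1 by omega]
    · intro k _ hk
      rw [coeff_C_mul, coeff_X_pow, if_neg (Ne.symm hk), mul_zero]
    · intro h
      exact absurd (Finset.mem_range.mpr (by omega)) h
  · intro u hu
    rw [hE', add_mul, Finset.sum_mul, mul_add, ← add_assoc, eval_finsetSum, Finset.mul_sum,
      ← Finset.sum_add_distrib]
    congr 1
    · refine Finset.sum_congr rfl fun m _ => ?_
      have h := hR' (m + 1) u hu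
      simp only [eval_mul, eval_C, eval_finsetSum, eval_pow, eval_X]
      have e : (-(x : ℂ) * (u * (1 - u)⁻¹)) ^ m / (m.factorial : ℂ) * (1 - u)⁻¹ ^ 2
          = (-(x : ℂ)) ^ m / (m.factorial : ℂ) * u ^ m * ((1 - u)⁻¹) ^ (m + 1 + 1) := by
        rw [mul_pow, mul_pow]
        ring
      rw [e, h]
      ring
    · rw [mul_pow, mul_pow, mul_pow]
      ring

lemma stmt7_ode (t : ℝ)
    (K : ℂ → ℂ) (hK : DifferentiableOn ℂ K (Metric.ball 0 1))
    (hKre : ∀ z ∈ Metric.ball (0 : ℂ) 1, 0 < (K z).re)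
    (hKxi : ∀ z ∈ Metric.ball (0 : ℂ) 1,
      ((K z - 1) / (K z + 1)) * Complex.exp (t * K z) = z) :
    ∀ z ∈ Metric.ball (0 : ℂ) 1,
      ((t : ℂ) * (K z) ^ 2 + (2 - t)) * (z * deriv K z) = (K z) ^ 2 - 1 := by
  intro z hz
  have hnhds := Metric.isOpen_ball.mem_nhds hz
  have hd : HasDerivAt K (deriv K z) z := (hK.differentiableAt hnhds).hasDerivAt
  have hne : K z + 1 ≠ 0 := by
    intro h
    have := congrArg Complex.re h
    have := hKre z hz
    simp at *
    linarith
  have h1 := ((hd.sub_const 1).div (hd.add_const 1) hne).mul (hd.const_mul (t : ℂ)).cexp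
  have h2 : HasDerivAt (fun z : ℂ => z) 1 z := hasDerivAt_id z
  have h3 := h1.congr_of_eventuallyEq (f₁ := fun z : ℂ => z) (by
    filter_upwards [hnhds] with w hw
    exact (hKxi w hw).symm)
  have h4 := h3.unique h2
  have h5 := hKxi z hz
  have he := Complex.exp_ne_zero (t * K z)
  simp only [Pi.div_apply] at h4
  generalize Complex.exp (t * K z) = e at *
  have h6 : deriv K z * (2 + t * (K z ^ 2 - 1)) * e = (K z + 1) ^ 2 := by
    field_simp at h4
    linear_combination h4
  have h7 : z * (K z + 1) = (K z - 1) * e := by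
    have h9 : z = (K z - 1) / (K z + 1) * e := h5.symm
    rw [div_mul_eq_mul_div, eq_div_iff hne] at h9
    exact h9
  have h8 : e * (K z + 1) ≠ 0 := mul_ne_zero he hne
  rw [← mul_right_inj' h8]
  linear_combination (z * (K z + 1)) * h6 + (K z + 1) ^ 2 * h7

lemma coeff_integral (t : ℝ)
    (K : ℂ → ℂ) (hK : DifferentiableOn ℂ K (Metric.ball 0 1))
    (hKre : ∀ z ∈ Metric.ball (0 : ℂ) 1, 0 < (K z).re)
    (hKxi : ∀ z ∈ Metric.ball (0 : ℂ) 1,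
      ((K z - 1) / (K z + 1)) * Complex.exp (t * K z) = z)
    (n : ℕ) (r : ℝ) (hr0 : 0 < r) (hr1 : r < 1) :
    (∮ z in C(0, r), (z⁻¹) ^ (n + 1) * deriv K z) = 2 * Real.pi * Complex.I *
      (2 * Complex.exp (-((n : ℂ) + 1) * t) *
          ((Lag n 1 (2 * ((n : ℝ) + 1) * t) : ℝ) : ℂ)) := by
  obtain ⟨P, R, hR, hP, hPR⟩ := gen_taylor n (2 * ((n : ℝ) + 1) * t)
  have hsub : Metric.closedBall (0 : ℂ) r ⊆ Metric.ball 0 1 :=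
    Metric.closedBall_subset_ball hr1
  have hsph : Metric.sphere (0 : ℂ) r ⊆ Metric.ball 0 1 :=
    Metric.sphere_subset_closedBall.trans hsub
  have hne : ∀ z ∈ Metric.ball (0 : ℂ) 1, K z + 1 ≠ 0 := by
    intro z hz h
    have := congrArg Complex.re h
    have := hKre z hz
    simp at *
    linarith
  have hK' : DifferentiableOn ℂ (deriv K) (Metric.ball 0 1) := hK.deriv Metric.isOpen_ball
  set u : ℂ → ℂ := fun z => (K z - 1) / (K z + 1) with hu
  have hud : DifferentiableOn ℂ u (Metric.ball 0 1) :=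
    (hK.sub_const 1).div (hK.add_const 1) hne
  set u' : ℂ → ℂ := fun z => 2 * deriv K z / (K z + 1) ^ 2 with hu'
  have hud' : DifferentiableOn ℂ u' (Metric.ball 0 1) :=
    (hK'.const_mul 2).div ((hK.add_const 1).pow 2) (fun z hz => pow_ne_zero 2 (hne z hz))
  have hder : ∀ z ∈ Metric.ball (0 : ℂ) 1, HasDerivAt u (u' z) z := by
    intro z hz
    have hd : HasDerivAt K (deriv K z) z :=
      (hK.differentiableAt (Metric.isOpen_ball.mem_nhds hz)).hasDerivAt
    have h1 := (hd.sub_const 1).div (hd.add_const 1) (hne z hz)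
    refine h1.congr_deriv ?_
    simp only [hu']
    ring
  have hub : Set.MapsTo u (Metric.ball 0 1) (Metric.ball 0 1) := by
    intro z hz
    have h1 := hKre z hz
    rw [mem_ball_zero_iff]
    simp only [hu, norm_div]
    rw [div_lt_one (norm_pos_iff.mpr (hne z hz))]
    rw [← sq_lt_sq₀ (norm_nonneg _) (norm_nonneg _), ← Complex.normSq_eq_norm_sq,
      ← Complex.normSq_eq_norm_sq, Complex.normSq_apply, Complex.normSq_apply]
    simp
    nlinarith
  have hz0 : ∀ z ∈ Metric.sphere (0 : ℂ) r, z ≠ 0 := by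
    intro z hz h
    rw [h] at hz
    simp at hz
    linarith
  have hu0 : ∀ z ∈ Metric.sphere (0 : ℂ) r, u z ≠ 0 := by
    intro z hz h
    have h1 := hKxi z (hsph hz)
    apply hz0 z hz
    rw [← h1]
    change u z * _ = 0
    rw [h, zero_mul]
  have hcirc : ∀ f : ℂ → ℂ, ContinuousOn f (Metric.sphere 0 r) → CircleIntegrable f 0 r :=
    fun f hf => hf.circleIntegrable hr0.le
  have huc : ContinuousOn u (Metric.sphere 0 r) := hud.continuousOn.mono hsph
  have huc' : ContinuousOn u' (Metric.sphere 0 r) := hud'.continuousOn.mono hsph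
  have hRc : DifferentiableOn ℂ (fun z => R (u z) * u' z) (Metric.ball 0 1) :=
    (hR.comp hud hub).mul hud'
  set A : ℂ := 2 * Complex.exp (-((n : ℂ) + 1) * t) with hA
  have hpt : Set.EqOn (fun z => (z⁻¹) ^ (n + 1) * deriv K z)
      (fun z => A * ((∑ k ∈ P.support, P.coeff k * (u z ^ ((k : ℤ) - n - 1) * u' z))
        + R (u z) * u' z)) (Metric.sphere 0 r) := by
    intro z hz
    have hz1 := hsph hz
    have hK1 := hne z hz1
    have hu1 := hu0 z hz
    have h1 := hPR (u z) (hub hz1)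
    have hinv : (1 - u z)⁻¹ = (K z + 1) / 2 := by
      have : 1 - u z = 2 / (K z + 1) := by
        simp only [hu]
        field_simp
        ring
      rw [this, inv_div]
    have hfrac : u z * (1 - u z)⁻¹ = (K z - 1) / 2 := by
      rw [hinv]
      simp only [hu]
      field_simp
    rw [hfrac, hinv] at h1
    have h2 : z⁻¹ ^ (n + 1) = (u z)⁻¹ ^ (n + 1) * Complex.exp (-((n : ℂ) + 1) * t * K z) := by
      have h3 : u z * Complex.exp (t * K z) = z := hKxi z hz1
      have h3' : z⁻¹ = (u z * Complex.exp (t * K z))⁻¹ := by rw [h3]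
      rw [h3', mul_inv, mul_pow, ← Complex.exp_neg, ← Complex.exp_nat_mul]
      congr 2
      push_cast
      ring
    have h4 : Complex.exp (-((n : ℂ) + 1) * t * K z) = Complex.exp (-((n : ℂ) + 1) * t) *
        Complex.exp (-((2 * ((n : ℝ) + 1) * t : ℝ) : ℂ) * ((K z - 1) / 2)) := by
      rw [← Complex.exp_add]
      congr 1
      push_cast
      ring
    have h5 : deriv K z = 2 * ((K z + 1) / 2) ^ 2 * u' z := by
      simp only [hu']
      field_simp
    have h6 : ∑ k ∈ P.support, P.coeff k * (u z ^ ((k : ℤ) - n - 1) * u' z)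
        = (u z)⁻¹ ^ (n + 1) * P.eval (u z) * u' z := by
      rw [Polynomial.eval_eq_sum, Polynomial.sum, Finset.mul_sum, Finset.sum_mul]
      refine Finset.sum_congr rfl fun k _ => ?_
      have : u z ^ ((k : ℤ) - n - 1) = (u z)⁻¹ ^ (n + 1) * u z ^ k := by
        rw [show (k : ℤ) - n - 1 = -((n + 1 : ℕ) : ℤ) + (k : ℤ) by push_cast; ring,
          zpow_add₀ hu1, zpow_neg, zpow_natCast, zpow_natCast, inv_pow]
      rw [this]
      ring
    have h7 : (u z)⁻¹ ^ (n + 1) * u z ^ (n + 1) = 1 := by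
      rw [← mul_pow, inv_mul_cancel₀ hu1, one_pow]
    change z⁻¹ ^ (n + 1) * deriv K z = _
    simp only []
    rw [h6, h2, h4, h5, hA]
    linear_combination (2 * Complex.exp (-((n : ℂ) + 1) * t) * (u z)⁻¹ ^ (n + 1) * u' z) * h1
      + (2 * Complex.exp (-((n : ℂ) + 1) * t) * R (u z) * u' z) * h7
  rw [circleIntegral.integral_congr hr0.le hpt, circleIntegral.integral_const_mul]
  have hzc : ∀ k : ℕ, ContinuousOn (fun z => P.coeff k * (u z ^ ((k : ℤ) - n - 1) * u' z))
      (Metric.sphere 0 r) := fun k =>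
    continuousOn_const.mul ((huc.zpow₀ _ (fun z hz => Or.inl (hu0 z hz))).mul huc')
  rw [circleIntegral.integral_add (hcirc _ (continuousOn_finsetSum _ fun k _ => hzc k))
    (hcirc _ (hRc.continuousOn.mono hsph)),
    circleIntegral.integral_fun_sum (fun k _ => hcirc _ (hzc k))]
  have hR0 : (∮ z in C(0, r), R (u z) * u' z) = 0 :=
    Complex.circleIntegral_eq_zero_of_differentiable_on_off_countable hr0.le
      Set.countable_empty (hRc.continuousOn.mono hsub) (fun z hz =>
        hRc.differentiableAt (Metric.isOpen_ball.mem_nhds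
          (hsub (Metric.ball_subset_closedBall hz.1))))
  have hk0 : ∀ k : ℕ, k ≠ n → (∮ z in C(0, r), u z ^ ((k : ℤ) - n - 1) * u' z) = 0 := by
    intro k hk
    have hkn : ((k : ℂ) - n) ≠ 0 := by
      rw [sub_ne_zero]
      exact_mod_cast hk
    refine circleIntegral.integral_eq_zero_of_hasDerivWithinAt
      (f := fun z => u z ^ ((k : ℤ) - n) / ((k : ℂ) - n)) hr0.le (fun z hz => ?_)
    have h1 := ((hasDerivAt_zpow ((k : ℤ) - n) (u z) (Or.inl (hu0 z hz))).comp z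
      (hder z (hsph hz))).div_const ((k : ℂ) - n)
    refine (h1.congr_deriv ?_).hasDerivWithinAt
    push_cast
    field_simp
  have hkn : (∮ z in C(0, r), u z ^ ((n : ℤ) - n - 1) * u' z) = 2 * Real.pi * Complex.I := by
    have h1 : Set.EqOn (fun z => u z ^ ((n : ℤ) - n - 1) * u' z)
        (fun z => (z - 0)⁻¹ + (-(t : ℂ)) * deriv K z) (Metric.sphere 0 r) := by
      intro z hz
      have hz1 := hsph hz
      have h3 := stmt7_ode t K hK hKre hKxi z hz1
      have hK1 := hne z hz1
      have hu1 := hu0 z hz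
      have hzz := hz0 z hz
      have hKm : K z - 1 ≠ 0 := by
        intro h
        apply hu1
        simp only [hu]
        rw [h, zero_div]
      simp only [sub_self, zero_sub, zpow_neg, zpow_one, sub_zero]
      simp only [hu, hu']
      field_simp
      linear_combination h3
    rw [circleIntegral.integral_congr hr0.le h1, circleIntegral.integral_add,
      circleIntegral.integral_sub_center_inv _ hr0.ne', circleIntegral.integral_const_mul]
    · have : (∮ z in C(0, r), deriv K z) = 0 :=
        circleIntegral.integral_eq_zero_of_hasDerivWithinAt hr0.le (f := K) (fun z hz =>
          (hK.differentiableAt (Metric.isOpen_ball.mem_nhds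
            (hsph hz))).hasDerivAt.hasDerivWithinAt)
      rw [this]
      ring
    · refine hcirc _ (ContinuousOn.inv₀ (by fun_prop) (fun z hz => ?_))
      rw [sub_zero]
      exact hz0 z hz
    · exact hcirc _ (continuousOn_const.mul (hK'.continuousOn.mono hsph))
  rw [hR0, add_zero, Finset.sum_eq_single n]
  · rw [circleIntegral.integral_const_mul, hkn, hP]
    ring
  · intro k _ hk
    rw [circleIntegral.integral_const_mul, hk0 k hk, mul_zero]
  · intro h
    rw [circleIntegral.integral_const_mul, Polynomial.notMem_support_iff.mp h, zero_mul]

theorem stmt7 (t : ℝ) (ht : 0 < t)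
    (K : ℂ → ℂ) (hK : DifferentiableOn ℂ K (Metric.ball 0 1)) (hK0 : K 0 = 1)
    (hKre : ∀ z ∈ Metric.ball (0 : ℂ) 1, 0 < (K z).re)
    (hKxi : ∀ z ∈ Metric.ball (0 : ℂ) 1,
      ((K z - 1) / (K z + 1)) * Complex.exp (t * K z) = z) :
    ∀ z ∈ Metric.ball (0 : ℂ) 1,
      HasSum (fun j : ℕ => 2 * Complex.exp (-((j : ℂ) + 1) * t) *
          ((Lag j 1 (2 * ((j : ℝ) + 1) * t) : ℝ) : ℂ) * z ^ (j + 1)) (z * deriv K z) ∧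
      ((t : ℂ) * (K z) ^ 2 + (2 - t)) * (z * deriv K z) = (K z) ^ 2 - 1 := by
  intro z hz
  refine ⟨?_, stmt7_ode t K hK hKre hKxi z hz⟩
  have hz1 : ‖z‖ < 1 := mem_ball_zero_iff.mp hz
  obtain ⟨r, hzr, hr1⟩ := exists_between hz1
  have hr0 : 0 < r := (norm_nonneg z).trans_lt hzr
  have hK' : DifferentiableOn ℂ (deriv K) (Metric.ball 0 1) := hK.deriv Metric.isOpen_ball
  lift r to NNReal using hr0.le
  have hps := (hK'.mono (Metric.closedBall_subset_ball hr1)).hasFPowerSeriesOnBall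
    (by exact_mod_cast hr0)
  have hs := hps.hasSum (y := z) (by
    rw [Metric.mem_eball, edist_zero_right, ← ofReal_norm,
      ← ENNReal.ofReal_coe_nnreal]
    exact (ENNReal.ofReal_lt_ofReal_iff hr0).mpr hzr)
  rw [zero_add] at hs
  have hs2 := hs.mul_left z
  refine hs2.congr_fun ?_
  intro n
  have hc := coeff_integral t K hK hKre hKxi n r hr0 hr1
  have hpi : (2 * Real.pi * Complex.I : ℂ) ≠ 0 := Complex.two_pi_I_ne_zero
  rw [cauchyPowerSeries_apply]
  have : (fun w : ℂ => (z / (w - 0)) ^ n • (w - 0)⁻¹ • deriv K w)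
      = fun w => z ^ n * (w⁻¹ ^ (n + 1) * deriv K w) := by
    funext w
    simp only [sub_zero, smul_eq_mul, div_eq_mul_inv, mul_pow, pow_succ]
    ring
  rw [this, circleIntegral.integral_const_mul, hc, smul_eq_mul]
  field_simp
  ring
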